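/- arXiv:1806.05077 — 3 statements merged into one kernel-verified Lean document; each statement's English description precedes it below -/
import Mathlib

section
/- Let m ≥ 1 and let ξ be an m-dimensional centered Gaussian random vector such that E[(ξ^j)^2] ≥ a^2 for every j = 1,…,m and some constant a > 0. Then for every y ∈ ℝ^m and every ε > 0 one has P(ξ ≤ y + ε) − P(ξ ≤ y) ≤ (ε/a)(√(2 log m) + 2). -/
open MeasureTheory ProbabilityTheory Filter
open scoped ENNReal NNReal Topology

lemma pdf_form (μ x : ℝ) : gaussianPDFReal μ 1 x =
    (√(2 * Real.pi))⁻¹ * Real.exp (-(x - μ) ^ 2 / 2) := by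
  simp [gaussianPDFReal]

lemma pdf_const_le : (√(2 * Real.pi))⁻¹ ≤ 1 := by
  apply inv_le_one_of_one_le₀
  rw [Real.one_le_sqrt]
  nlinarith [Real.pi_gt_three]

lemma pdf_hasDeriv (μ x : ℝ) :
    HasDerivAt (gaussianPDFReal μ 1) (-(x - μ) * gaussianPDFReal μ 1 x) x := by
  have h : gaussianPDFReal μ 1 = fun x => (√(2 * Real.pi))⁻¹ * Real.exp (-(x - μ) ^ 2 / 2) := by
    ext x; exact pdf_form μ x
  rw [h]
  have h1 : HasDerivAt (fun x : ℝ => -(x - μ) ^ 2 / 2) (-(x - μ)) x := by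
    have := ((((hasDerivAt_id x).sub_const μ).pow 2).neg).div_const 2
    convert! this using 1
    simp; ring
  have := (h1.exp).const_mul ((√(2 * Real.pi))⁻¹)
  convert! this using 1
  ring

lemma pdf_mills (μ x : ℝ) (hx : μ ≤ x) :
    gaussianPDFReal μ 1 x ≤ (x - μ + 1) * ∫ u in Set.Ioi x, gaussianPDFReal μ 1 u := by
  set g : ℝ → ℝ := fun u => -(gaussianPDFReal μ 1 u / (u - μ + 1)) with hg
  set g' : ℝ → ℝ := fun u => gaussianPDFReal μ 1 u * ((u - μ) / (u - μ + 1) + 1 / (u - μ + 1) ^ 2)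
    with hg'
  have hd : ∀ u ∈ Set.Ici x, HasDerivAt g (g' u) u := by
    intro u hu
    have hu' : 0 < u - μ + 1 := by have := Set.mem_Ici.1 hu; linarith
    have h2 : HasDerivAt (fun u : ℝ => u - μ + 1) 1 u :=
      ((hasDerivAt_id u).sub_const μ).add_const 1
    have := ((pdf_hasDeriv μ u).div h2 hu'.ne').neg
    convert! this using 1
    simp only [hg']
    field_simp
    ring
  have hpos : ∀ u ∈ Set.Ioi x, 0 ≤ g' u := by
    intro u hu
    have hu' : 0 ≤ u - μ := by have := Set.mem_Ioi.1 hu; linarith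
    have := gaussianPDFReal_nonneg μ 1 u
    simp only [hg']
    positivity
  have hle : ∀ u ∈ Set.Ioi x, g' u ≤ gaussianPDFReal μ 1 u := by
    intro u hu
    have hu' : 0 ≤ u - μ := by have := Set.mem_Ioi.1 hu; linarith
    have := gaussianPDFReal_nonneg μ 1 u
    simp only [hg']
    apply mul_le_of_le_one_right this
    rw [div_add_div _ _ (by positivity) (by positivity), div_le_one (by positivity)]
    nlinarith [mul_nonneg hu' hu', mul_nonneg (mul_nonneg hu' hu') hu']
  have hlim : Tendsto g atTop (𝓝 0) := by
    have h3 : Tendsto (fun u : ℝ => (u - μ + 1)⁻¹) atTop (𝓝 0) := by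
      apply Tendsto.comp tendsto_inv_atTop_zero
      apply tendsto_atTop_add_const_right
      exact tendsto_atTop_add_const_right _ (-μ) tendsto_id
    rw [← neg_zero]
    apply Tendsto.neg
    apply squeeze_zero_norm' _ h3
    filter_upwards [eventually_ge_atTop μ] with u hu
    have hu' : 0 ≤ u - μ := by linarith
    have h0 := gaussianPDFReal_nonneg μ 1 u
    rw [Real.norm_of_nonneg (by positivity), div_eq_mul_inv]
    apply mul_le_of_le_one_left (by positivity)
    rw [pdf_form]
    apply mul_le_one₀ pdf_const_le (by positivity)
    apply Real.exp_le_one_iff.2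
    nlinarith
  have hI := integral_Ioi_of_hasDerivAt_of_nonneg' hd hpos hlim
  have hint := integrableOn_Ioi_deriv_of_nonneg' hd hpos hlim
  have hmono : ∫ u in Set.Ioi x, g' u ≤ ∫ u in Set.Ioi x, gaussianPDFReal μ 1 u :=
    setIntegral_mono_on hint (integrable_gaussianPDFReal μ 1).integrableOn measurableSet_Ioi hle
  rw [hI] at hmono
  simp only [hg, zero_sub, neg_neg] at hmono
  rw [div_le_iff₀ (by linarith)] at hmono
  linarith

lemma pdf_bound (m : ℕ) (hm : 1 ≤ m) (μ x : ℝ) :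
    gaussianPDFReal μ 1 x ≤ (√(2 * Real.log m) + 1) * (∫ u in Set.Ioi x, gaussianPDFReal μ 1 u)
      + (m : ℝ)⁻¹ := by
  have hm0 : (0 : ℝ) < m := by exact_mod_cast hm
  have hI : ∀ x, 0 ≤ ∫ u in Set.Ioi x, gaussianPDFReal μ 1 u := fun x =>
    integral_nonneg fun u => gaussianPDFReal_nonneg μ 1 u
  have hL := Real.sqrt_nonneg (2 * Real.log m)
  have hL2 : √(2 * Real.log m) ^ 2 = 2 * Real.log m := by
    apply Real.sq_sqrt
    have := Real.log_nonneg (x := m) (by exact_mod_cast hm)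
    linarith
  set L := √(2 * Real.log m)
  have hmi : 0 ≤ (m : ℝ)⁻¹ := by positivity
  rcases le_or_gt L (x - μ) with h | h
  · have : gaussianPDFReal μ 1 x ≤ (m : ℝ)⁻¹ := by
      rw [pdf_form]
      calc _ ≤ 1 * Real.exp (- Real.log m) := by
            apply mul_le_mul pdf_const_le _ (by positivity) (by positivity)
            apply Real.exp_le_exp.2
            nlinarith
        _ = _ := by rw [Real.exp_neg, Real.exp_log hm0, one_mul]
    have := mul_nonneg (by linarith : 0 ≤ L + 1) (hI x)
    linarith
  · rcases le_or_gt μ x with h' | h'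
    · have h1 := pdf_mills μ x h'
      have h2 : (x - μ + 1) * ∫ u in Set.Ioi x, gaussianPDFReal μ 1 u ≤
        (L + 1) * ∫ u in Set.Ioi x, gaussianPDFReal μ 1 u :=
        mul_le_mul_of_nonneg_right (by linarith) (hI x)
      linarith
    · have h1 := pdf_mills μ μ le_rfl
      have h2 : gaussianPDFReal μ 1 x ≤ gaussianPDFReal μ 1 μ := by
        rw [pdf_form, pdf_form]
        apply mul_le_mul_of_nonneg_left _ (by positivity)
        apply Real.exp_le_exp.2
        nlinarith
      have h3 : ∫ u in Set.Ioi μ, gaussianPDFReal μ 1 u ≤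
          ∫ u in Set.Ioi x, gaussianPDFReal μ 1 u := by
        apply setIntegral_mono_set (integrable_gaussianPDFReal μ 1).integrableOn
        · exact ae_of_all _ fun u => gaussianPDFReal_nonneg μ 1 u
        · exact (Set.Ioi_subset_Ioi h'.le).eventuallyLE
      have := mul_nonneg hL (hI x)
      linarith

lemma pdf_bound_enn (m : ℕ) (hm : 1 ≤ m) (μ x : ℝ) :
    gaussianPDF μ 1 x ≤ ENNReal.ofReal (√(2 * Real.log m) + 1) * gaussianReal μ 1 (Set.Ioi x)
      + ENNReal.ofReal (m : ℝ)⁻¹ := by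
  rw [gaussianReal_apply_eq_integral μ one_ne_zero, ← ENNReal.ofReal_mul (by positivity),
    ← ENNReal.ofReal_add _ (by positivity)]
  · exact ENNReal.ofReal_le_ofReal (pdf_bound m hm μ x)
  · exact mul_nonneg (by positivity) (integral_nonneg fun u => gaussianPDFReal_nonneg μ 1 u)

lemma upper_bound (m : ℕ) (hm : 1 ≤ m) (μ δ : ℝ) (T : Set ℝ) (hT : IsUpperSet T)
    (hTm : MeasurableSet T) :
    gaussianReal μ 1 (T ∩ Set.Ioc 0 δ) ≤ ∫⁻ t in Set.Ioc 0 δ,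
      (ENNReal.ofReal (√(2 * Real.log m) + 1) * gaussianReal μ 1 (T ∩ Set.Ioi t)
        + ENNReal.ofReal (m : ℝ)⁻¹) := by
  rw [gaussianReal_apply μ one_ne_zero, ← lintegral_indicator (hTm.inter measurableSet_Ioc),
    ← lintegral_indicator measurableSet_Ioc]
  apply lintegral_mono
  intro t
  by_cases h : t ∈ T ∩ Set.Ioc 0 δ
  · rw [Set.indicator_of_mem h, Set.indicator_of_mem h.2]
    have : T ∩ Set.Ioi t = Set.Ioi t :=
      Set.inter_eq_right.2 fun u hu => hT (le_of_lt hu) h.1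
    rw [this]
    exact pdf_bound_enn m hm μ t
  · rw [Set.indicator_of_notMem h]
    exact zero_le

lemma cov_le_one {Ω : Type*} [MeasurableSpace Ω] (P : Measure Ω) [IsProbabilityMeasure P]
    (X Y : Ω → ℝ) (hX : MemLp X 2 P) (hY : MemLp Y 2 P) (h1 : Var[X; P] = 1) (h2 : Var[Y; P] = 1) :
    cov[X, Y; P] ≤ 1 := by
  have h := variance_nonneg (X - Y) P
  rw [variance_sub hX hY, h1, h2] at h
  linarith

def argmaxSet {Ω : Type*} {m : ℕ} (X : Ω → Fin m → ℝ) (j : Fin m) : Set Ω :=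
  {ω | ∀ i, X ω i ≤ X ω j ∧ (i < j → X ω i < X ω j)}

lemma gauss_indep {Ω : Type*} [MeasurableSpace Ω] (P : Measure Ω) [IsProbabilityMeasure P]
    (m : ℕ) (X : Ω → Fin m → ℝ) (hX : HasGaussianLaw X P) (j : Fin m)
    (hmem : ∀ j, MemLp (fun ω => X ω j) 2 P)
    (hvar : Var[fun ω => X ω j; P] = 1) :
    IndepFun (fun ω => X ω j)
      (fun ω i => X ω i - cov[fun ω => X ω i, fun ω => X ω j; P] * X ω j) P := by
  set ρ : Fin m → ℝ := fun i => cov[fun ω => X ω i, fun ω => X ω j; P]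
  have h1 := hX.map_fun (F := (Unit → ℝ) × (Fin m → ℝ))
    ((ContinuousLinearMap.pi fun _ => ContinuousLinearMap.proj j).prod
      (ContinuousLinearMap.pi fun i => ContinuousLinearMap.proj i - ρ i • ContinuousLinearMap.proj j))
  have h2 : HasGaussianLaw (fun ω => ((fun _ : Unit => X ω j),
      (fun i => X ω i - ρ i * X ω j))) P := h1
  have h3 := HasGaussianLaw.indepFun_of_covariance_eval (ι := Unit) (κ := Fin m)
    (X := fun _ ω => X ω j) (Y := fun i ω => X ω i - ρ i * X ω j) h2 (by
      intro _ i
      rw [covariance_fun_sub_right (hmem j) (hmem i) ((hmem j).const_mul _),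
        covariance_const_mul_right, covariance_self (hmem j).aestronglyMeasurable.aemeasurable, hvar,
        covariance_comm]
      simp [ρ])
  exact h3.comp (φ := fun f : Unit → ℝ => f ()) (ψ := id) (by fun_prop) measurable_id

lemma piece_bound {Ω : Type*} [MeasurableSpace Ω] (P : Measure Ω) [IsProbabilityMeasure P]
    (m : ℕ) (hm : 1 ≤ m) (X : Ω → Fin m → ℝ) (hXm : Measurable X)
    (hX : HasGaussianLaw X P) (hvar : ∀ j, Var[fun ω => X ω j; P] = 1) (j : Fin m) (δ : ℝ) :
    P (argmaxSet X j ∩ {ω | X ω j ∈ Set.Ioc 0 δ}) ≤ ∫⁻ t in Set.Ioc 0 δ,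
      (ENNReal.ofReal (√(2 * Real.log m) + 1) * P (argmaxSet X j ∩ {ω | X ω j ∈ Set.Ioi t})
        + ENNReal.ofReal (m : ℝ)⁻¹) := by
  have hmem : ∀ j, MemLp (fun ω => X ω j) 2 P := fun j =>
    (hX.map_fun (ContinuousLinearMap.proj (R := ℝ) (φ := fun _ : Fin m => ℝ) j)).memLp_two
  have hind := gauss_indep P m X hX j hmem (hvar j)
  have hlaw : P.map (fun ω => X ω j) = gaussianReal P[fun ω => X ω j] 1 := by
    have hXj : HasGaussianLaw (fun ω => X ω j) P :=
      hX.map_fun (ContinuousLinearMap.proj (R := ℝ) (φ := fun _ : Fin m => ℝ) j)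
    rw [hXj.map_eq_gaussianReal, hvar j]
    simp
  have hρ : ∀ i, cov[fun ω => X ω i, fun ω => X ω j; P] ≤ 1 := fun i =>
    cov_le_one P _ _ (hmem i) (hmem j) (hvar i) (hvar j)
  set ρ : Fin m → ℝ := fun i => cov[fun ω => X ω i, fun ω => X ω j; P] with hρdef
  have hVm : Measurable (fun ω i => X ω i - ρ i * X ω j) := by fun_prop
  have hjm : Measurable (fun ω => X ω j) := by fun_prop
  have hprod := (indepFun_iff_map_prod_eq_prod_map_map hjm.aemeasurable hVm.aemeasurable).1 hind
  rw [hlaw] at hprod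
  set ν := P.map (fun ω i => X ω i - ρ i * X ω j)
  have : IsProbabilityMeasure ν := Measure.isProbabilityMeasure_map hVm.aemeasurable
  set γ := gaussianReal P[fun ω => X ω j] 1 with hγ
  set S : Set (ℝ × (Fin m → ℝ)) :=
    {p | ∀ i, p.2 i + ρ i * p.1 ≤ p.1 ∧ (i < j → p.2 i + ρ i * p.1 < p.1)} with hS
  have hSm : MeasurableSet S := by
    have : S = ⋂ i, ({p | p.2 i + ρ i * p.1 ≤ p.1} ∩
      {p | i < j → p.2 i + ρ i * p.1 < p.1}) := by
      ext p; simp [hS]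
    rw [this]
    refine MeasurableSet.iInter fun i => MeasurableSet.inter ?_ ?_
    · exact measurableSet_le (by fun_prop) (by fun_prop)
    · by_cases h : i < j
      · simp only [h, true_imp_iff]
        exact measurableSet_lt (by fun_prop) (by fun_prop)
      · simp [h]
  have hup : ∀ v, IsUpperSet ((fun x : ℝ => (x, v)) ⁻¹' S) := by
    intro v x x' hxx hx i
    have h1 := hx i
    have h2 := mul_le_mul_of_nonneg_left hxx (sub_nonneg.2 (hρ i))
    simp only at h1 ⊢
    constructor
    · have := h1.1
      change v i + ρ i * x' ≤ x'
      change (1 - ρ i) * x ≤ (1 - ρ i) * x' at h2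
      linarith
    · intro hij
      have := h1.2 hij
      change v i + ρ i * x' < x'
      change (1 - ρ i) * x ≤ (1 - ρ i) * x' at h2
      linarith
  have key : ∀ I : Set ℝ, MeasurableSet I → P (argmaxSet X j ∩ {ω | X ω j ∈ I}) =
      ∫⁻ v, γ (((fun x : ℝ => (x, v)) ⁻¹' S) ∩ I) ∂ν := by
    intro I hI
    have e : argmaxSet X j ∩ {ω | X ω j ∈ I} =
        (fun ω => (X ω j, fun i => X ω i - ρ i * X ω j)) ⁻¹' (S ∩ Prod.fst ⁻¹' I) := by
      ext ω
      simp [argmaxSet, hS]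
    rw [e, ← Measure.map_apply (hjm.prodMk hVm) (hSm.inter (measurable_fst hI)), hprod,
      Measure.prod_apply_symm (hSm.inter (measurable_fst hI))]
    rfl
  have hmeas2 : Measurable (fun p : (Fin m → ℝ) × ℝ =>
      γ (((fun x : ℝ => (x, p.1)) ⁻¹' S) ∩ Set.Ioi p.2)) := by
    have hU : MeasurableSet {q : ((Fin m → ℝ) × ℝ) × ℝ | (q.2, q.1.1) ∈ S ∧ q.1.2 < q.2} := by
      apply MeasurableSet.inter
      · exact (by fun_prop : Measurable (fun q : ((Fin m → ℝ) × ℝ) × ℝ => (q.2, q.1.1))) hSm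
      · exact measurableSet_lt (f := fun q : ((Fin m → ℝ) × ℝ) × ℝ => q.1.2) (g := fun q => q.2)
          (by fun_prop) (by fun_prop)
    exact measurable_measure_prodMk_left hU
  rw [key _ measurableSet_Ioc]
  calc _ ≤ ∫⁻ v, (∫⁻ t in Set.Ioc 0 δ, (ENNReal.ofReal (√(2 * Real.log m) + 1) *
          γ (((fun x : ℝ => (x, v)) ⁻¹' S) ∩ Set.Ioi t) + ENNReal.ofReal (m : ℝ)⁻¹)) ∂ν := by
        apply lintegral_mono
        intro v
        exact upper_bound m hm _ δ _ (hup v)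
          ((by fun_prop : Measurable (fun x : ℝ => (x, v))) hSm)
    _ = ∫⁻ t in Set.Ioc 0 δ, (∫⁻ v, (ENNReal.ofReal (√(2 * Real.log m) + 1) *
          γ (((fun x : ℝ => (x, v)) ⁻¹' S) ∩ Set.Ioi t) + ENNReal.ofReal (m : ℝ)⁻¹) ∂ν) := by
        apply lintegral_lintegral_swap
        exact ((hmeas2.const_mul _).add_const _).aemeasurable
    _ = _ := by
        apply lintegral_congr
        intro t
        have hmt : Measurable (fun v => γ (((fun x : ℝ => (x, v)) ⁻¹' S) ∩ Set.Ioi t)) :=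
          hmeas2.comp (by fun_prop : Measurable (fun v : Fin m → ℝ => (v, t)))
        rw [lintegral_add_right _ measurable_const, lintegral_const_mul _ hmt,
          key _ measurableSet_Ioi]
        simp

lemma argmax_disj {Ω : Type*} {m : ℕ} (X : Ω → Fin m → ℝ) :
    Pairwise (Function.onFun Disjoint (argmaxSet X)) := by
  intro i j hij
  rw [Function.onFun, Set.disjoint_left]
  intro ω hi hj
  rcases lt_or_gt_of_ne hij with h | h
  · have := (hj i).2 h
    have := (hi j).1
    linarith
  · have := (hi j).2 h
    have := (hj i).1
    linarith

lemma argmax_meas {Ω : Type*} [MeasurableSpace Ω] {m : ℕ} (X : Ω → Fin m → ℝ) (hXm : Measurable X)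
    (j : Fin m) : MeasurableSet (argmaxSet X j) := by
  have : argmaxSet X j = ⋂ i, ({ω | X ω i ≤ X ω j} ∩ {ω | i < j → X ω i < X ω j}) := by
    ext p; simp [argmaxSet]
  rw [this]
  refine MeasurableSet.iInter fun i => MeasurableSet.inter ?_ ?_
  · exact measurableSet_le (by fun_prop) (by fun_prop)
  · by_cases h : i < j
    · simp only [h, true_imp_iff]
      exact measurableSet_lt (by fun_prop) (by fun_prop)
    · simp [h]

lemma argmax_exists {m : ℕ} (hm : 1 ≤ m) {Ω : Type*} (X : Ω → Fin m → ℝ) (ω : Ω) :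
    ∃ j, ω ∈ argmaxSet X j := by
  have : Nonempty (Fin m) := ⟨⟨0, hm⟩⟩
  obtain ⟨k, hk⟩ := Finite.exists_max (X ω)
  obtain ⟨j, hj, hjmin⟩ := WellFounded.has_min (wellFounded_lt (α := Fin m))
    {j | ∀ i, X ω i ≤ X ω j} ⟨k, hk⟩
  refine ⟨j, fun i => ⟨hj i, fun hij => ?_⟩⟩
  by_contra hcon
  push Not at hcon
  exact hjmin i (fun l => (hj l).trans hcon) hij

lemma unit_bound {Ω : Type*} [MeasurableSpace Ω] (P : Measure Ω) [IsProbabilityMeasure P]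
    (m : ℕ) (hm : 1 ≤ m) (X : Ω → Fin m → ℝ) (hXm : Measurable X)
    (hX : HasGaussianLaw X P) (hvar : ∀ j, Var[fun ω => X ω j; P] = 1) (δ : ℝ) :
    P {ω | (∀ j, X ω j ≤ δ) ∧ ¬ ∀ j, X ω j ≤ 0} ≤
      ENNReal.ofReal (√(2 * Real.log m) + 2) * ENNReal.ofReal δ := by
  have hm0 : (0 : ℝ) < m := by exact_mod_cast hm
  have hsub : {ω | (∀ j, X ω j ≤ δ) ∧ ¬ ∀ j, X ω j ≤ 0} ⊆
      ⋃ j, (argmaxSet X j ∩ {ω | X ω j ∈ Set.Ioc 0 δ}) := by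
    rintro ω ⟨h1, h2⟩
    obtain ⟨j, hj⟩ := argmax_exists hm X ω
    refine Set.mem_iUnion.2 ⟨j, hj, ?_, h1 j⟩
    by_contra hcon
    exact h2 fun i => ((hj i).1).trans (not_lt.1 hcon)
  have hanti : ∀ j, Measurable fun t : ℝ => P (argmaxSet X j ∩ {ω | X ω j ∈ Set.Ioi t}) := by
    intro j
    apply Antitone.measurable
    intro s t hst
    apply measure_mono
    rintro ω ⟨h1, h2⟩
    exact ⟨h1, lt_of_le_of_lt hst h2⟩
  calc _ ≤ _ := measure_mono hsub
    _ ≤ ∑ j, P (argmaxSet X j ∩ {ω | X ω j ∈ Set.Ioc 0 δ}) := measure_iUnion_fintype_le _ _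
    _ ≤ ∑ j, ∫⁻ t in Set.Ioc 0 δ,
      (ENNReal.ofReal (√(2 * Real.log m) + 1) * P (argmaxSet X j ∩ {ω | X ω j ∈ Set.Ioi t})
        + ENNReal.ofReal (m : ℝ)⁻¹) :=
        Finset.sum_le_sum fun j _ => piece_bound P m hm X hXm hX hvar j δ
    _ = ∫⁻ t in Set.Ioc 0 δ, ∑ j,
      (ENNReal.ofReal (√(2 * Real.log m) + 1) * P (argmaxSet X j ∩ {ω | X ω j ∈ Set.Ioi t})
        + ENNReal.ofReal (m : ℝ)⁻¹) := by
        rw [lintegral_finsetSum]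
        intro j _
        exact ((hanti j).const_mul _).add_const _
    _ ≤ ∫⁻ t in Set.Ioc 0 δ, ENNReal.ofReal (√(2 * Real.log m) + 2) := by
        apply lintegral_mono
        intro t
        simp only
        rw [Finset.sum_add_distrib, ← Finset.mul_sum]
        have h1 : ∑ j, P (argmaxSet X j ∩ {ω | X ω j ∈ Set.Ioi t}) ≤ 1 := by
          calc _ ≤ ∑ j, P (argmaxSet X j) :=
                Finset.sum_le_sum fun j _ => measure_mono Set.inter_subset_left
            _ = P (⋃ j, argmaxSet X j) := by
                rw [measure_iUnion (argmax_disj X) (argmax_meas X hXm), tsum_fintype]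
            _ ≤ 1 := prob_le_one
        have h2 : ∑ _j : Fin m, ENNReal.ofReal (m : ℝ)⁻¹ = 1 := by
          rw [← ENNReal.ofReal_sum_of_nonneg (fun _ _ => by positivity)]
          simp [hm0.ne']
        rw [h2]
        calc _ ≤ ENNReal.ofReal (√(2 * Real.log m) + 1) * 1 + 1 := by gcongr
          _ = _ := by
            rw [mul_one, ← ENNReal.ofReal_one, ← ENNReal.ofReal_add (by positivity) (by positivity)]
            congr 1; ring
    _ = _ := by
        rw [lintegral_const, Measure.restrict_apply MeasurableSet.univ]
        simp

theorem stmt0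
    {Ω : Type*} [MeasureSpace Ω] [IsProbabilityMeasure (ℙ : Measure Ω)]
    (m : ℕ) (hm : 1 ≤ m)
    (ξ : Ω → Fin m → ℝ) (hmeas : Measurable ξ)
    (hgauss : ∀ t : Fin m → ℝ, ∃ v : ℝ≥0,
      Measure.map (fun ω => ∑ j, t j * ξ ω j) ℙ = gaussianReal 0 v)
    (a : ℝ) (ha : 0 < a)
    (hvar : ∀ j, a ^ 2 ≤ ∫ ω, (ξ ω j) ^ 2 ∂ℙ)
    (y : Fin m → ℝ) (ε : ℝ) (hε : 0 < ε) :
    (ℙ {ω | ∀ j, ξ ω j ≤ y j + ε}).toReal - (ℙ {ω | ∀ j, ξ ω j ≤ y j}).toReal ≤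
      (ε / a) * (Real.sqrt (2 * Real.log m) + 2) := by
  have hG : HasGaussianLaw ξ (ℙ : Measure Ω) := by
    constructor
    apply isGaussian_of_isGaussian_map
    intro L
    obtain ⟨v, hv⟩ := hgauss (fun j => L (Pi.single j 1))
    have e : (fun ω => ∑ j, L (Pi.single j 1) * ξ ω j) = L ∘ ξ := by
      ext ω
      have := LinearMap.pi_apply_eq_sum_univ (L : (Fin m → ℝ) →ₗ[ℝ] ℝ) (ξ ω)
      simp only [ContinuousLinearMap.coe_coe, smul_eq_mul] at this
      rw [Function.comp_apply, this]
      refine Finset.sum_congr rfl fun j _ => ?_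
      rw [mul_comm]
      congr 2
      ext i
      simp [Pi.single_apply, eq_comm]
    rw [Measure.map_map L.continuous.measurable hmeas, ← e, hv]
    infer_instance
  have hGj : ∀ j, HasGaussianLaw (fun ω => ξ ω j) (ℙ : Measure Ω) := fun j =>
    hG.map_fun (ContinuousLinearMap.proj (R := ℝ) (φ := fun _ : Fin m => ℝ) j)
  have hjm : ∀ j, Measurable (fun ω => ξ ω j) := fun j => by fun_prop
  have hmean : ∀ j, ∫ ω, ξ ω j = 0 := by
    intro j
    obtain ⟨v, hv⟩ := hgauss (Pi.single j 1)
    have e : (fun ω => ∑ i, (Pi.single j 1 : Fin m → ℝ) i * ξ ω i) = fun ω => ξ ω j := by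
      ext ω; simp [Pi.single_apply]
    rw [e] at hv
    have := integral_map (μ := (ℙ : Measure Ω)) (hjm j).aemeasurable
      (f := fun x : ℝ => x) (by fun_prop)
    rw [hv, integral_id_gaussianReal] at this
    exact this.symm
  have hV : ∀ j, a ^ 2 ≤ Var[fun ω => ξ ω j; ℙ] := by
    intro j
    rw [variance_of_integral_eq_zero (hjm j).aemeasurable (hmean j)]
    exact hvar j
  set σ : Fin m → ℝ := fun j => √(Var[fun ω => ξ ω j; ℙ]) with hσ
  have hσa : ∀ j, a ≤ σ j := fun j => Real.le_sqrt_of_sq_le (hV j)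
  have hσ0 : ∀ j, 0 < σ j := fun j => ha.trans_le (hσa j)
  have hσ2 : ∀ j, σ j ^ 2 = Var[fun ω => ξ ω j; ℙ] := fun j => Real.sq_sqrt (variance_nonneg _ _)
  set X : Ω → Fin m → ℝ := fun ω j => (σ j)⁻¹ * ξ ω j - (σ j)⁻¹ * y j with hXdef
  have hXm : Measurable X := by fun_prop
  have hXG : HasGaussianLaw X (ℙ : Measure Ω) := by
    have h0 := hG.map_fun (F := Fin m → ℝ) (ContinuousLinearMap.pi fun j =>
      (σ j)⁻¹ • ContinuousLinearMap.proj (R := ℝ) (φ := fun _ : Fin m => ℝ) j)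
    have h1 : HasGaussianLaw (fun ω j => (σ j)⁻¹ * ξ ω j) (ℙ : Measure Ω) := by
      convert! h0 using 2
    have := h1.isGaussian_map
    constructor
    have e : Measure.map X ℙ = (Measure.map (fun ω j => (σ j)⁻¹ * ξ ω j) (ℙ : Measure Ω)).map
        (fun x => x - fun j => (σ j)⁻¹ * y j) := by
      rw [Measure.map_map (by fun_prop) (by fun_prop)]
      rfl
    rw [e]
    infer_instance
  have hXv : ∀ j, Var[fun ω => X ω j; ℙ] = 1 := by
    intro j
    simp only [hXdef]
    rw [variance_sub_const (by fun_prop), variance_const_mul, ← hσ2 j]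
    have := hσ0 j
    field_simp
  have hub := unit_bound (ℙ : Measure Ω) m hm X hXm hXG hXv (ε / a)
  have hmS : MeasurableSet {ω | ∀ j, ξ ω j ≤ y j} := by
    rw [Set.ofPred_forall]
    exact MeasurableSet.iInter fun j => measurableSet_le (hjm j) measurable_const
  have hsub : {ω | ∀ j, ξ ω j ≤ y j} ⊆ {ω | ∀ j, ξ ω j ≤ y j + ε} := fun ω h j => by
    have := h j; linarith
  have hdiff : (ℙ {ω | ∀ j, ξ ω j ≤ y j + ε}).toReal - (ℙ {ω | ∀ j, ξ ω j ≤ y j}).toReal =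
      (ℙ ({ω | ∀ j, ξ ω j ≤ y j + ε} \ {ω | ∀ j, ξ ω j ≤ y j})).toReal := by
    rw [measure_sdiff hsub hmS.nullMeasurableSet (measure_ne_top _ _),
      ENNReal.toReal_sub_of_le (measure_mono hsub) (measure_ne_top _ _)]
  rw [hdiff]
  have hX0 : ∀ ω j, X ω j ≤ 0 ↔ ξ ω j ≤ y j := by
    intro ω j
    simp only [hXdef]
    rw [sub_nonpos, mul_le_mul_iff_right₀ (inv_pos.2 (hσ0 j))]
  have hincl : {ω | ∀ j, ξ ω j ≤ y j + ε} \ {ω | ∀ j, ξ ω j ≤ y j} ⊆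
      {ω | (∀ j, X ω j ≤ ε / a) ∧ ¬ ∀ j, X ω j ≤ 0} := by
    rintro ω ⟨h1, h2⟩
    refine ⟨fun j => ?_, fun h => h2 fun j => (hX0 ω j).1 (h j)⟩
    simp only [hXdef]
    rw [← mul_sub]
    have h3 : ξ ω j - y j ≤ ε := by have := h1 j; linarith
    calc _ ≤ (σ j)⁻¹ * ε := mul_le_mul_of_nonneg_left h3 (inv_pos.2 (hσ0 j)).le
      _ ≤ a⁻¹ * ε := mul_le_mul_of_nonneg_right (inv_anti₀ ha (hσa j)) hε.le
      _ = ε / a := by rw [mul_comm, div_eq_mul_inv]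
  have hfin := (measure_mono hincl).trans hub
  rw [← ENNReal.ofReal_mul (by positivity)] at hfin
  have := ENNReal.toReal_le_of_le_ofReal (by positivity) hfin
  linarith
end

section
/- Let m ≥ 3, ε > 0, β := ε^{−1} log m, and define the smooth max function Φ_β : ℝ^m → ℝ by Φ_β(w) := β^{−1} log( Σ_{j=1}^m exp(β w^j) ). Then: (i) 0 ≤ Φ_β(w) − max_{1≤j≤m} w^j ≤ β^{−1} log m = ε for every w ∈ ℝ^m; and (ii) for every C^∞ function g : ℝ → ℝ which is bounded together with all its derivatives, and every integer s ≥ 1, there is a constant C_{g,s} > 0 depending only on g and s such that Σ_{j_1,…,j_s = 1}^m | ∂_{w^{j_1}}⋯∂_{w^{j_s}} [ g(ε^{−1} Φ_β(w)) ] | ≤ C_{g,s} · ε^{−s} (log m)^{s−1} for all w ∈ ℝ^m and all ε > 0. -/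
open Filter
open scoped Topology

noncomputable section

/-- partial derivative -/
def pd {m : ℕ} (k : Fin m) (f : (Fin m → ℝ) → ℝ) : (Fin m → ℝ) → ℝ :=
  fun v => fderiv ℝ f v (Pi.single k (1 : ℝ))

/-- l1 norm of the derivative array -/
def nn {m : ℕ} : ℕ → ((Fin m → ℝ) → ℝ) → (Fin m → ℝ) → ℝ
  | 0, f, w => |f w|
  | s + 1, f, w => ∑ k, nn s (pd k f) w

abbrev Sm {m : ℕ} (f : (Fin m → ℝ) → ℝ) : Prop := ContDiff ℝ (⊤ : ℕ∞) f

lemma Sm.diff {m : ℕ} {f : (Fin m → ℝ) → ℝ} (hf : Sm f) : Differentiable ℝ f :=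
  ContDiff.differentiable hf (by simp)

lemma Sm.fd {m : ℕ} {f : (Fin m → ℝ) → ℝ} (hf : Sm f) : ContDiff ℝ (⊤ : ℕ∞) (fderiv ℝ f) :=
  ContDiff.fderiv_right hf (by simp)

lemma Sm.pd {m : ℕ} {f : (Fin m → ℝ) → ℝ} (hf : Sm f) (k : Fin m) : Sm (pd k f) :=
  hf.fd.clm_apply contDiff_const

lemma nn_nonneg {m : ℕ} (s : ℕ) : ∀ (f : (Fin m → ℝ) → ℝ) w, 0 ≤ nn s f w := by
  induction s with
  | zero => intro f w; exact abs_nonneg _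
  | succ s ih => intro f w; exact Finset.sum_nonneg fun k _ => ih _ _

lemma pd_add {m : ℕ} {f g : (Fin m → ℝ) → ℝ} (hf : Sm f) (hg : Sm g) (k : Fin m) :
    pd k (fun v => f v + g v) = fun v => pd k f v + pd k g v := by
  funext v
  have := ((hf.diff v).hasFDerivAt.add (hg.diff v).hasFDerivAt).fderiv
  simp only [pd]
  erw [this]; simp

lemma pd_mul {m : ℕ} {f g : (Fin m → ℝ) → ℝ} (hf : Sm f) (hg : Sm g) (k : Fin m) :
    pd k (fun v => f v * g v) = fun v => pd k f v * g v + f v * pd k g v := by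
  funext v
  have := ((hf.diff v).hasFDerivAt.mul (hg.diff v).hasFDerivAt).fderiv
  simp only [pd]
  erw [this]; simp; ring

lemma pd_cmul {m : ℕ} {f : (Fin m → ℝ) → ℝ} (hf : Sm f) (c : ℝ) (k : Fin m) :
    pd k (fun v => c * f v) = fun v => c * pd k f v := by
  funext v
  have := ((hf.diff v).hasFDerivAt.const_mul c).fderiv
  simp only [pd]
  erw [this]; simp

lemma nn_cmul {m : ℕ} (s : ℕ) : ∀ {f : (Fin m → ℝ) → ℝ} (_ : Sm f) (c : ℝ) w,
    nn s (fun v => c * f v) w = |c| * nn s f w := by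
  induction s with
  | zero => intro f hf c w; exact abs_mul _ _
  | succ s ih =>
    intro f hf c w
    simp only [nn, Finset.mul_sum]
    refine Finset.sum_congr rfl fun k _ => ?_
    rw [pd_cmul hf, ih (hf.pd k)]

lemma nn_add {m : ℕ} (s : ℕ) : ∀ {f g : (Fin m → ℝ) → ℝ} (_ : Sm f) (_ : Sm g) w,
    nn s (fun v => f v + g v) w ≤ nn s f w + nn s g w := by
  induction s with
  | zero => intro f g hf hg w; exact abs_add_le _ _
  | succ s ih =>
    intro f g hf hg w
    simp only [nn, ← Finset.sum_add_distrib]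
    refine Finset.sum_le_sum fun k _ => ?_
    rw [pd_add hf hg]; exact ih (hf.pd k) (hg.pd k) w

lemma nn_mul {m : ℕ} (s : ℕ) : ∀ {f g : (Fin m → ℝ) → ℝ} (_ : Sm f) (_ : Sm g) w,
    nn s (fun v => f v * g v) w ≤
      2 ^ s * ∑ x ∈ Finset.HasAntidiagonal.antidiagonal s, nn x.1 f w * nn x.2 g w := by
  induction s with
  | zero => intro f g hf hg w; simp [nn, abs_mul]
  | succ s ih =>
    intro f g hf hg w
    have h1 : nn (s + 1) (fun v => f v * g v) w ≤
        ∑ k, (2 ^ s * ∑ x ∈ Finset.HasAntidiagonal.antidiagonal s, nn x.1 (pd k f) w * nn x.2 g w +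
          2 ^ s * ∑ x ∈ Finset.HasAntidiagonal.antidiagonal s, nn x.1 f w * nn x.2 (pd k g) w) := by
      simp only [nn]
      refine Finset.sum_le_sum fun k _ => ?_
      rw [pd_mul hf hg]
      refine (nn_add s ((hf.pd k).mul hg) (hf.mul (hg.pd k)) w).trans ?_
      exact add_le_add (ih (hf.pd k) hg w) (ih hf (hg.pd k) w)
    have h2 : ∑ k, (2 ^ s * ∑ x ∈ Finset.HasAntidiagonal.antidiagonal s, nn x.1 (pd k f) w * nn x.2 g w +
          2 ^ s * ∑ x ∈ Finset.HasAntidiagonal.antidiagonal s, nn x.1 f w * nn x.2 (pd k g) w) =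
        2 ^ s * ∑ x ∈ Finset.HasAntidiagonal.antidiagonal s, nn (x.1 + 1) f w * nn x.2 g w +
          2 ^ s * ∑ x ∈ Finset.HasAntidiagonal.antidiagonal s, nn x.1 f w * nn (x.2 + 1) g w := by
      rw [Finset.sum_add_distrib, ← Finset.mul_sum, ← Finset.mul_sum, Finset.sum_comm]
      rw [Finset.sum_comm (s := Finset.univ)]
      simp only [nn, Finset.sum_mul, Finset.mul_sum]
    rw [h2] at h1
    have h3 := Finset.Nat.sum_antidiagonal_succ (n := s)
      (f := fun x : ℕ × ℕ => nn x.1 f w * nn x.2 g w)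
    have h4 := Finset.Nat.sum_antidiagonal_succ' (n := s)
      (f := fun x : ℕ × ℕ => nn x.1 f w * nn x.2 g w)
    have h5 := mul_nonneg (nn_nonneg 0 f w) (nn_nonneg (s + 1) g w)
    have h6 := mul_nonneg (nn_nonneg (s + 1) f w) (nn_nonneg 0 g w)
    simp only at h3 h4
    refine h1.trans ?_
    rw [pow_succ, mul_assoc, two_mul, mul_add]
    refine add_le_add ?_ ?_ <;> refine mul_le_mul_of_nonneg_left ?_ (by positivity)
    · rw [h3]; linarith
    · rw [h4]; linarith

lemma nn_eq {m : ℕ} (s : ℕ) : ∀ {f : (Fin m → ℝ) → ℝ} (_ : Sm f) w,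
    ∑ jj : Fin s → Fin m, |iteratedFDeriv ℝ s f w (fun t => Pi.single (jj t) (1 : ℝ))| =
      nn s f w := by
  induction s with
  | zero => intro f hf w; simp [nn]
  | succ s ih =>
    intro f hf w
    rw [← (Fin.snocEquiv (fun _ => Fin m)).sum_comp, Fintype.sum_prod_type]
    simp only [nn]
    refine Finset.sum_congr rfl fun k _ => ?_
    rw [← ih (hf.pd k)]
    refine Finset.sum_congr rfl fun jj _ => ?_
    rw [iteratedFDeriv_succ_apply_right]
    have h := ContinuousLinearMap.iteratedFDeriv_comp_left
      (ContinuousLinearMap.apply ℝ ℝ (Pi.single k (1 : ℝ) : Fin m → ℝ))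
      (f := fderiv ℝ f) (x := w) (i := s) (hf.fd.contDiffAt) (by exact_mod_cast le_top)
    have h' : (⇑(ContinuousLinearMap.apply ℝ ℝ (Pi.single k (1 : ℝ) : Fin m → ℝ)) ∘ fderiv ℝ f)
      = pd k f := by funext v; simp [pd]
    rw [h'] at h
    rw [h]
    simp [Fin.init_def]

/-- partition function -/
def zz {m : ℕ} (b : ℝ) (v : Fin m → ℝ) : ℝ := ∑ j, Real.exp (b * v j)

/-- softmax -/
def pp {m : ℕ} (b : ℝ) (j : Fin m) (v : Fin m → ℝ) : ℝ := Real.exp (b * v j) / zz b v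

lemma zz_pos {m : ℕ} (hm : 3 ≤ m) (b : ℝ) (v : Fin m → ℝ) : 0 < zz b v := by
  have : Nonempty (Fin m) := ⟨⟨0, by omega⟩⟩
  exact Finset.sum_pos (fun j _ => Real.exp_pos _) Finset.univ_nonempty

lemma sm_exp {m : ℕ} (b : ℝ) (j : Fin m) : Sm (fun v : Fin m → ℝ => Real.exp (b * v j)) := by
  unfold Sm; fun_prop

lemma sm_zz {m : ℕ} (b : ℝ) : Sm (zz (m := m) b) := by
  unfold Sm zz; fun_prop

lemma sm_pp {m : ℕ} (hm : 3 ≤ m) (b : ℝ) (j : Fin m) : Sm (pp b j) :=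
  (sm_exp b j).div (sm_zz b) fun v => (zz_pos hm b v).ne'

lemma sm_log {m : ℕ} (hm : 3 ≤ m) (b : ℝ) : Sm (fun v : Fin m → ℝ => Real.log (zz b v)) :=
  (sm_zz b).log fun v => (zz_pos hm b v).ne'

lemma pd_exp {m : ℕ} (b : ℝ) (j k : Fin m) (v : Fin m → ℝ) :
    pd k (fun v : Fin m → ℝ => Real.exp (b * v j)) v =
      b * ((if j = k then 1 else 0) * Real.exp (b * v j)) := by
  have h : HasFDerivAt (fun v : Fin m → ℝ => Real.exp (b * v j)) _ v :=
    ((hasFDerivAt_apply (𝕜 := ℝ) j v).const_mul b).exp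
  simp only [pd]
  rw [h.fderiv]
  simp [Pi.single_apply, mul_comm]

lemma pd_zz {m : ℕ} (b : ℝ) (k : Fin m) (v : Fin m → ℝ) :
    pd k (zz b) v = b * Real.exp (b * v k) := by
  have h : HasFDerivAt (zz b) _ v := 
    HasFDerivAt.fun_sum (u := Finset.univ) fun j _ => ((sm_exp b j).diff v).hasFDerivAt
  have h2 := fun j => pd_exp b j k v
  simp only [pd] at h2 ⊢
  rw [h.fderiv]
  simp [h2]

lemma pd_comp {m : ℕ} {f : (Fin m → ℝ) → ℝ} (hf : Sm f) {g : ℝ → ℝ} {g' : ℝ} (k : Fin m)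
    (v : Fin m → ℝ) (hg : HasDerivAt g g' (f v)) :
    pd k (fun v => g (f v)) v = g' * pd k f v := by
  have h : HasFDerivAt (fun v => g (f v)) _ v := hg.comp_hasFDerivAt v (hf.diff v).hasFDerivAt
  simp only [pd]
  rw [h.fderiv]; simp

lemma pd_log {m : ℕ} (hm : 3 ≤ m) (b : ℝ) (k : Fin m) (v : Fin m → ℝ) :
    pd k (fun v => Real.log (zz b v)) v = b * pp b k v := by
  rw [pd_comp (sm_zz b) k v (Real.hasDerivAt_log (zz_pos hm b v).ne'), pd_zz, pp]
  ring

lemma pd_pp {m : ℕ} (hm : 3 ≤ m) (b : ℝ) (j k : Fin m) :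
    pd k (pp b j) = fun v => (b * if j = k then 1 else 0) * pp b j v +
      (-b) * (pp b j v * pp b k v) := by
  have e : pp b j = fun v : Fin m → ℝ => Real.exp (b * v j) * (zz b v)⁻¹ := by
    funext v; rw [pp, div_eq_mul_inv]
  have hi : Sm (fun v : Fin m → ℝ => (zz b v)⁻¹) :=
    (sm_zz b).inv fun v => (zz_pos hm b v).ne'
  have h0 : pd k (pp b j) = pd k (fun v : Fin m → ℝ => Real.exp (b * v j) * (zz b v)⁻¹) := by
    rw [e]
  rw [h0, pd_mul (sm_exp b j) hi]
  funext v
  have hz := (zz_pos hm b v).ne'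
  rw [pd_exp, pd_comp (sm_zz b) k v (hasDerivAt_inv hz), pd_zz, pp, pp]
  field_simp

lemma pp_nonneg {m : ℕ} (hm : 3 ≤ m) (b : ℝ) (j : Fin m) (v) : 0 ≤ pp b j v :=
  div_nonneg (Real.exp_pos _).le (zz_pos hm b v).le

lemma pp_sum {m : ℕ} (hm : 3 ≤ m) (b : ℝ) (v : Fin m → ℝ) : ∑ j, pp b j v = 1 := by
  simp only [pp]
  rw [← Finset.sum_div]; exact div_self (zz_pos hm b v).ne'

lemma pp_bound (s : ℕ) : ∃ c : ℝ, 0 ≤ c ∧ ∀ i ≤ s, ∀ m : ℕ, 3 ≤ m → ∀ b : ℝ, 0 < b →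
    ∀ w : Fin m → ℝ, ∑ j, nn i (pp b j) w ≤ c * b ^ i := by
  induction s with
  | zero =>
    refine ⟨1, zero_le_one, fun i hi m hm b hb w => ?_⟩
    obtain rfl : i = 0 := by omega
    simp only [nn, abs_of_nonneg (pp_nonneg hm b _ w), pp_sum hm]
    simp
  | succ s ih =>
    obtain ⟨c, hc, h⟩ := ih
    refine ⟨c + 2 ^ s * ((s + 1) * c ^ 2), by positivity, fun i hi m hm b hb w => ?_⟩
    rcases Nat.lt_or_ge i (s + 1) with hlt | hge
    · refine (h i (by omega) m hm b hb w).trans ?_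
      gcongr
      have : 0 ≤ 2 ^ s * ((s + 1) * c ^ 2) := by positivity
      linarith
    obtain rfl : i = s + 1 := by omega
    have h1 : ∀ j k : Fin m, nn s (pd k (pp b j)) w ≤
        b * ((if j = k then nn s (pp b j) w else 0) +
          2 ^ s * ∑ x ∈ Finset.HasAntidiagonal.antidiagonal s, nn x.1 (pp b j) w * nn x.2 (pp b k) w) := by
      intro j k
      rw [pd_pp hm]
      have hj := sm_pp hm b j
      have hk := sm_pp hm b k
      refine (nn_add s (contDiff_const.mul hj) (contDiff_const.mul (hj.mul hk)) w).trans ?_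
      rw [nn_cmul s hj, nn_cmul s (hj.mul hk), abs_neg, abs_of_pos hb, mul_add]
      refine add_le_add (le_of_eq ?_) (mul_le_mul_of_nonneg_left (nn_mul s hj hk w) hb.le)
      split_ifs <;> simp [abs_of_pos hb]
    have h2 : ∑ j, nn (s + 1) (pp b j) w ≤ b * ((∑ j, nn s (pp b j) w) + 2 ^ s *
        ∑ x ∈ Finset.HasAntidiagonal.antidiagonal s, (∑ j, nn x.1 (pp b j) w) * ∑ k, nn x.2 (pp b k) w) := by
      simp only [nn]
      refine (Finset.sum_le_sum fun j _ => Finset.sum_le_sum fun k _ => h1 j k).trans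
        (le_of_eq ?_)
      simp only [← Finset.mul_sum, Finset.sum_add_distrib]
      congr 2
      · simp
      · congr 1
        simp only [Finset.sum_mul_sum]
        rw [Finset.sum_comm]
        conv_rhs => rw [Finset.sum_comm]
        rw [Finset.sum_comm]
        refine Finset.sum_congr rfl fun j _ => ?_
        rw [Finset.sum_comm]
    refine h2.trans ?_
    have h3 : ∑ x ∈ Finset.HasAntidiagonal.antidiagonal s, (∑ j, nn x.1 (pp b j) w) * ∑ k, nn x.2 (pp b k) w
        ≤ (s + 1) * (c ^ 2 * b ^ s) := by
      have : ∀ x ∈ Finset.HasAntidiagonal.antidiagonal s, (∑ j, nn x.1 (pp b j) w) * ∑ k, nn x.2 (pp b k) w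
          ≤ c ^ 2 * b ^ s := by
        intro x hx
        rw [Finset.HasAntidiagonal.mem_antidiagonal] at hx
        calc _ ≤ (c * b ^ x.1) * (c * b ^ x.2) :=
              mul_le_mul (h _ (by omega) m hm b hb w) (h _ (by omega) m hm b hb w)
                (Finset.sum_nonneg fun _ _ => nn_nonneg _ _ _) (by positivity)
          _ = _ := by rw [← hx, pow_add]; ring
      refine (Finset.sum_le_card_nsmul _ _ _ this).trans (le_of_eq ?_)
      simp
    calc _ ≤ b * (c * b ^ s + 2 ^ s * ((s + 1) * (c ^ 2 * b ^ s))) := by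
          gcongr
          exact h s le_rfl m hm b hb w
      _ = _ := by ring

abbrev Gd (g : ℝ → ℝ) : Prop :=
  ContDiff ℝ (⊤ : ℕ∞) g ∧ ∀ k : ℕ, ∃ M : ℝ, ∀ t : ℝ, |iteratedDeriv k g t| ≤ M

lemma Gd.deriv {g : ℝ → ℝ} (hg : Gd g) : Gd (deriv g) := by
  refine ⟨?_, fun k => ?_⟩
  · exact ((contDiff_succ_iff_deriv (n := (⊤ : ℕ∞))).1 (by simpa using hg.1)).2.2
  · obtain ⟨M, hM⟩ := hg.2 (k + 1)
    exact ⟨M, fun t => by rw [← iteratedDeriv_succ']; exact hM t⟩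

/-- composite function -/
def gu {m : ℕ} (g : ℝ → ℝ) (e l : ℝ) (v : Fin m → ℝ) : ℝ := g (l⁻¹ * Real.log (zz (e * l) v))

lemma sm_gu {m : ℕ} (hm : 3 ≤ m) {g : ℝ → ℝ} (hg : Gd g) (e l : ℝ) : Sm (m := m) (gu g e l) :=
  hg.1.comp (contDiff_const.mul (sm_log hm (e * l)))

lemma pd_gu {m : ℕ} (hm : 3 ≤ m) {g : ℝ → ℝ} (hg : Gd g) (e l : ℝ) (hl : 1 ≤ l) (k : Fin m) :
    pd k (gu g e l) = fun v => e * (gu (deriv g) e l v * pp (e * l) k v) := by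
  funext v
  have hd : HasDerivAt g (deriv g (l⁻¹ * Real.log (zz (e * l) v)))
      (l⁻¹ * Real.log (zz (e * l) v)) :=
    ((hg.1.differentiable (by simp)) _).hasDerivAt
  have := pd_comp (contDiff_const.mul (sm_log hm (e * l)) :
    Sm (fun v : Fin m → ℝ => l⁻¹ * Real.log (zz (e * l) v))) k v hd
  unfold gu
  rw [this, pd_cmul (sm_log hm _)]
  simp only [pd_log hm]
  have : l ≠ 0 := by positivity
  field_simp

lemma step {s : ℕ} {c C : ℝ} (hc : 0 ≤ c) (hC : 0 ≤ C) {m : ℕ} (hm : 3 ≤ m) {e l : ℝ}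
    (he : 0 < e) (hl : 1 ≤ l) {g : ℝ → ℝ} (hg : Gd g) (w : Fin m → ℝ)
    (hp : ∀ i ≤ s, ∑ j, nn i (pp (e * l) j) w ≤ c * (e * l) ^ i)
    (hG : ∀ i ≤ s, nn i (gu (deriv g) e l) w ≤ C * (e * l) ^ i) :
    nn (s + 1) (gu g e l) w ≤ 2 ^ s * ((s + 1) * (C * c)) * (e * (e * l) ^ s) := by
  have hl0 : 0 < l := by linarith
  have h1 : nn (s + 1) (gu g e l) w ≤ e * (2 ^ s * ∑ x ∈ Finset.HasAntidiagonal.antidiagonal s,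
      nn x.1 (gu (deriv g) e l) w * ∑ k, nn x.2 (pp (e * l) k) w) := by
    simp only [nn, Finset.mul_sum]
    conv_rhs => rw [Finset.sum_comm]
    refine Finset.sum_le_sum fun k _ => ?_
    have a := sm_gu hm hg.deriv e l
    have b := sm_pp hm (e * l) k
    rw [pd_gu hm hg e l hl, nn_cmul s (a.mul b), abs_of_pos he]
    simp only [← Finset.mul_sum]
    exact mul_le_mul_of_nonneg_left (nn_mul s a b w) he.le
  have h3 : ∑ x ∈ Finset.HasAntidiagonal.antidiagonal s,
      nn x.1 (gu (deriv g) e l) w * ∑ k, nn x.2 (pp (e * l) k) w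
      ≤ (s + 1) * (C * c * (e * l) ^ s) := by
    have : ∀ x ∈ Finset.HasAntidiagonal.antidiagonal s,
        nn x.1 (gu (deriv g) e l) w * ∑ k, nn x.2 (pp (e * l) k) w ≤ C * c * (e * l) ^ s := by
      intro x hx
      rw [Finset.HasAntidiagonal.mem_antidiagonal] at hx
      calc _ ≤ (C * (e * l) ^ x.1) * (c * (e * l) ^ x.2) :=
            mul_le_mul (hG _ (by omega)) (hp _ (by omega))
              (Finset.sum_nonneg fun _ _ => nn_nonneg _ _ _) (by positivity)
        _ = _ := by rw [← hx, pow_add]; ring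
    refine (Finset.sum_le_card_nsmul _ _ _ this).trans (le_of_eq ?_)
    simp
  calc _ ≤ e * (2 ^ s * ((s + 1) * (C * c * (e * l) ^ s))) := h1.trans (by gcongr)
    _ = _ := by ring

lemma gu_bound (s : ℕ) : ∀ g : ℝ → ℝ, Gd g → ∃ C : ℝ, 0 ≤ C ∧ ∀ i ≤ s, ∀ m : ℕ, 3 ≤ m →
    ∀ e l : ℝ, 0 < e → 1 ≤ l → ∀ w : Fin m → ℝ, nn i (gu g e l) w ≤ C * (e * l) ^ i := by
  induction s with
  | zero =>
    intro g hg
    obtain ⟨M, hM⟩ := hg.2 0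
    refine ⟨M, (abs_nonneg _).trans (hM 0), fun i hi m hm e l he hl w => ?_⟩
    obtain rfl : i = 0 := by omega
    simpa [nn, gu] using hM _
  | succ s ih =>
    intro g hg
    obtain ⟨C0, hC0, h0⟩ := ih g hg
    obtain ⟨C, hC, h⟩ := ih _ hg.deriv
    obtain ⟨c, hc, hp⟩ := pp_bound s
    refine ⟨C0 + 2 ^ s * ((s + 1) * (C * c)), by positivity, fun i hi m hm e l he hl w => ?_⟩
    have hl0 : 0 < l := by linarith
    rcases Nat.lt_or_ge i (s + 1) with hlt | hge
    · refine (h0 i (by omega) m hm e l he hl w).trans ?_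
      gcongr
      have : 0 ≤ 2 ^ s * ((s + 1) * (C * c)) := by positivity
      linarith
    obtain rfl : i = s + 1 := by omega
    refine (step hc hC hm he hl hg w (fun i hi => hp i hi m hm _ (by positivity) w)
      (fun i hi => h i hi m hm e l he hl w)).trans ?_
    rw [pow_succ' (e * l)]
    gcongr
    · linarith
    · nlinarith

lemma one_le_log {m : ℕ} (hm : 3 ≤ m) : 1 ≤ Real.log m := by
  rw [Real.le_log_iff_exp_le (by positivity)]
  have : (3 : ℝ) ≤ m := by exact_mod_cast hm
  linarith [Real.exp_one_lt_d9]

lemma part1 {m : ℕ} (hm : 3 ≤ m) {b : ℝ} (hb : 0 < b) (w : Fin m → ℝ) :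
    0 ≤ b⁻¹ * Real.log (zz b w) - (⨆ j, w j) ∧
    b⁻¹ * Real.log (zz b w) - (⨆ j, w j) ≤ b⁻¹ * Real.log m := by
  have : Nonempty (Fin m) := ⟨⟨0, by omega⟩⟩
  have hbd : BddAbove (Set.range w) := Set.finite_range w |>.bddAbove
  constructor
  · rw [sub_nonneg]
    refine ciSup_le fun j => ?_
    rw [inv_mul_eq_div, le_div_iff₀ hb, Real.le_log_iff_exp_le (zz_pos hm b w), mul_comm]
    exact Finset.single_le_sum (f := fun j => Real.exp (b * w j))
      (fun j _ => (Real.exp_pos _).le) (Finset.mem_univ j)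
  · have h : zz b w ≤ m * Real.exp (b * ⨆ j, w j) := by
      refine (Finset.sum_le_card_nsmul _ _ (Real.exp (b * ⨆ j, w j)) fun j _ => ?_).trans ?_
      · gcongr; exact le_ciSup hbd j
      · simp
    have hm0 : (m : ℝ) ≠ 0 := by norm_cast; omega
    have h2 := Real.log_le_log (zz_pos hm b w) h
    rw [Real.log_mul hm0 (Real.exp_pos _).ne', Real.log_exp] at h2
    rw [inv_mul_eq_div, inv_mul_eq_div, sub_le_iff_le_add, div_le_iff₀ hb, add_mul,
      div_mul_cancel₀ _ hb.ne']
    linarith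

end

/-- Properties of the smooth max function `Φ_β(w) = β⁻¹ log(∑_j exp(β w^j))` with
`β = ε⁻¹ log m`: (i) `0 ≤ Φ_β(w) − max_j w^j ≤ ε`; (ii) for every `C^∞` function
`g : ℝ → ℝ` bounded together with all its derivatives and every `s ≥ 1` there is a constant
`C > 0` depending only on `g` and `s` such that the `ℓ¹`-norm of the `s`-th derivative array
of `w ↦ g(ε⁻¹ Φ_β(w))` is at most `C ε^{−s} (log m)^{s−1}`. -/
theorem stmt8 :
    (∀ m : ℕ, 3 ≤ m → ∀ ε : ℝ, 0 < ε → ∀ w : Fin m → ℝ,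
      0 ≤ (ε⁻¹ * Real.log m)⁻¹ *
            Real.log (∑ j, Real.exp ((ε⁻¹ * Real.log m) * w j)) - (⨆ j, w j) ∧
      (ε⁻¹ * Real.log m)⁻¹ *
            Real.log (∑ j, Real.exp ((ε⁻¹ * Real.log m) * w j)) - (⨆ j, w j) ≤ ε) ∧
    (∀ g : ℝ → ℝ, ContDiff ℝ (⊤ : ℕ∞) g →
      (∀ k : ℕ, ∃ M : ℝ, ∀ t : ℝ, |iteratedDeriv k g t| ≤ M) →
      ∀ s : ℕ, 1 ≤ s →
        ∃ C : ℝ, 0 < C ∧ ∀ m : ℕ, 3 ≤ m → ∀ ε : ℝ, 0 < ε → ∀ w : Fin m → ℝ,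
          ∑ jj : Fin s → Fin m,
              |iteratedFDeriv ℝ s
                  (fun v : Fin m → ℝ => g (ε⁻¹ *
                    ((ε⁻¹ * Real.log m)⁻¹ *
                      Real.log (∑ j, Real.exp ((ε⁻¹ * Real.log m) * v j)))))
                  w (fun t => Pi.single (jj t) (1 : ℝ))| ≤
            C * ε⁻¹ ^ s * Real.log m ^ (s - 1)) := by
  refine ⟨fun m hm ε hε w => ?_, fun g hg hb s hs => ?_⟩
  · have hl := one_le_log hm
    have h := part1 hm (b := ε⁻¹ * Real.log m) (by positivity) w
    refine ⟨h.1, h.2.trans (le_of_eq ?_)⟩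
    have : Real.log m ≠ 0 := by positivity
    field_simp
  · obtain ⟨s, rfl⟩ : ∃ t, s = t + 1 := ⟨s - 1, by omega⟩
    have hG : Gd g := ⟨hg, hb⟩
    obtain ⟨C, hC, h⟩ := gu_bound s _ hG.deriv
    obtain ⟨c, hc, hp⟩ := pp_bound s
    refine ⟨2 ^ s * ((s + 1) * (C * c)) + 1, by positivity, fun m hm ε hε w => ?_⟩
    have hl := one_le_log hm
    have hl0 : 0 < Real.log m := by linarith
    have e : (fun v : Fin m → ℝ => g (ε⁻¹ *
                    ((ε⁻¹ * Real.log m)⁻¹ *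
                      Real.log (∑ j, Real.exp ((ε⁻¹ * Real.log m) * v j))))) =
        gu g ε⁻¹ (Real.log m) := by
      funext v
      unfold gu zz
      congr 1
      field_simp
    rw [e, nn_eq _ (sm_gu hm hG _ _)]
    have he : 0 < ε⁻¹ := inv_pos.2 hε
    refine (step hc hC hm he hl hG w (fun i hi => hp i hi m hm _ (by positivity) w)
      (fun i hi => h i hi m hm _ _ he hl w)).trans ?_
    have : ε⁻¹ * (ε⁻¹ * Real.log m) ^ s = ε⁻¹ ^ (s + 1) * Real.log m ^ s := by
      rw [mul_pow]; ring
    rw [this, Nat.add_sub_cancel, mul_assoc _ (ε⁻¹ ^ (s + 1))]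
    gcongr
    linarith
end

section
/- Let m ≥ 1, b > 0, and let ξ be an m-dimensional centered Gaussian vector with E[(ξ^j)^2] ≥ b for every j = 1,…,m. Then for any u, v ∈ ℝ^m: sup_{y ∈ ℝ^m} | P(ξ + u ≤ y) − P(ξ + v ≤ y) | ≤ (‖u − v‖_{ℓ∞} / √b) · (√(2 log m) + 2). -/
open MeasureTheory ProbabilityTheory Filter
open scoped ENNReal NNReal Topology

lemma phi_eq (x : ℝ) : gaussianPDFReal 0 1 x = (Real.sqrt (2 * Real.pi))⁻¹ * Real.exp (- x ^ 2 / 2) := by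
  simp [gaussianPDFReal]

lemma phi_hasDeriv (x : ℝ) : HasDerivAt (gaussianPDFReal 0 1) (-x * gaussianPDFReal 0 1 x) x := by
  have h : HasDerivAt (fun x : ℝ => (Real.sqrt (2 * Real.pi))⁻¹ * Real.exp (- x ^ 2 / 2))
      ((Real.sqrt (2 * Real.pi))⁻¹ * (Real.exp (- x ^ 2 / 2) * (-(2 * x) / 2))) x := by
    apply HasDerivAt.const_mul
    apply HasDerivAt.exp
    apply HasDerivAt.div_const
    have := (hasDerivAt_pow 2 x).neg
    simp only [Nat.cast_ofNat, Nat.add_one_sub_one, pow_one] at this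
    exact this
  rw [show gaussianPDFReal 0 1 = _ from funext phi_eq]
  convert h using 1
  ring

lemma phi_anti {x y : ℝ} (hx : |x| ≤ |y|) : gaussianPDFReal 0 1 y ≤ gaussianPDFReal 0 1 x := by
  rw [phi_eq, phi_eq]
  have := sq_le_sq.2 hx
  apply mul_le_mul_of_nonneg_left _ (by positivity)
  apply Real.exp_le_exp.2
  linarith

lemma phi_le_exp (x : ℝ) : gaussianPDFReal 0 1 x ≤ Real.exp (- x ^ 2 / 2) := by
  rw [phi_eq]
  have : (Real.sqrt (2 * Real.pi))⁻¹ ≤ 1 := by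
    apply inv_le_one_of_one_le₀
    rw [Real.one_le_sqrt]
    nlinarith [Real.pi_gt_three]
  nlinarith [Real.exp_pos (-x^2/2)]

lemma mills {a : ℝ} (ha : 0 ≤ a) :
    gaussianPDFReal 0 1 a ≤ (a + 1) * (gaussianReal 0 1 (Set.Ioi a)).toReal := by
  have hd : ∀ x ∈ Set.Ici a, HasDerivAt (fun x => - (gaussianPDFReal 0 1 x / (x + 1)))
      (gaussianPDFReal 0 1 x * (x / (x + 1) + 1 / (x + 1) ^ 2)) x := by
    intro x hx
    have hx0 : x + 1 ≠ 0 := by have : a ≤ x := hx; linarith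
    have := ((phi_hasDeriv x).div ((hasDerivAt_id x).add_const (1:ℝ)) hx0).neg
    refine (this.congr_deriv ?_)
    simp only [id_eq]
    field_simp
    ring
  have hn : ∀ x ∈ Set.Ioi a, 0 ≤ gaussianPDFReal 0 1 x * (x / (x + 1) + 1 / (x + 1) ^ 2) := by
    intro x hx
    have : 0 < x := lt_of_le_of_lt ha hx
    have := gaussianPDFReal_nonneg 0 1 x
    positivity
  have ht : Tendsto (fun x => - (gaussianPDFReal 0 1 x / (x + 1))) atTop (𝓝 0) := by
    suffices h : Tendsto (fun x => gaussianPDFReal 0 1 x / (x + 1)) atTop (𝓝 0) by simpa using h.neg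
    have h1 : Tendsto (fun x : ℝ => 1 / (x + 1)) atTop (𝓝 0) := by
      simp_rw [one_div]
      exact tendsto_inv_atTop_zero.comp (tendsto_atTop_add_const_right _ _ tendsto_id)
    refine squeeze_zero' (g := fun x : ℝ => 1 / (x + 1)) ?_ ?_ h1
    · filter_upwards [eventually_ge_atTop 0] with x hx
      have := gaussianPDFReal_nonneg 0 1 x
      positivity
    · filter_upwards [eventually_ge_atTop 0] with x hx
      gcongr
      refine (phi_le_exp x).trans ?_
      rw [Real.exp_le_one_iff]
      nlinarith [sq_nonneg x]
  have hi := integrableOn_Ioi_deriv_of_nonneg' hd hn ht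
  have he := integral_Ioi_of_hasDerivAt_of_nonneg' hd hn ht
  have hle : ∫ x in Set.Ioi a, gaussianPDFReal 0 1 x * (x / (x + 1) + 1 / (x + 1) ^ 2)
      ≤ ∫ x in Set.Ioi a, gaussianPDFReal 0 1 x := by
    refine setIntegral_mono_on hi (integrable_gaussianPDFReal 0 1).integrableOn measurableSet_Ioi ?_
    intro x hx
    have hx0 : 0 < x := lt_of_le_of_lt ha hx
    apply mul_le_of_le_one_right (gaussianPDFReal_nonneg 0 1 x)
    rw [div_add_div _ _ (by positivity) (by positivity), div_le_one (by positivity)]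
    nlinarith [pow_pos hx0 2, pow_pos hx0 3]
  rw [he] at hle
  rw [gaussianReal_apply_eq_integral 0 one_ne_zero, ENNReal.toReal_ofReal
    (integral_nonneg fun x => gaussianPDFReal_nonneg 0 1 x)]
  have h1 : 0 < a + 1 := by linarith
  have : gaussianPDFReal 0 1 a / (a + 1) ≤ ∫ x in Set.Ioi a, gaussianPDFReal 0 1 x := by linarith
  rw [div_le_iff₀ h1] at this
  linarith

lemma gap {a c : ℝ} : gaussianReal 0 1 (Set.Icc a c) ≤
    ENNReal.ofReal ((c - a) * gaussianPDFReal 0 1 (max a 0)) := by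
  rw [gaussianReal_apply 0 one_ne_zero]
  have : ∫⁻ x in Set.Icc a c, gaussianPDF 0 1 x ≤
      ∫⁻ x in Set.Icc a c, ENNReal.ofReal (gaussianPDFReal 0 1 (max a 0)) := by
    refine setLIntegral_mono' measurableSet_Icc fun x hx => ?_
    apply ENNReal.ofReal_le_ofReal
    apply phi_anti
    rw [abs_of_nonneg (le_max_right a 0)]
    exact max_le (hx.1.trans (le_abs_self x)) (abs_nonneg x)
  refine this.trans ?_
  rw [setLIntegral_const, Real.volume_Icc, mul_comm (c - a), 
    ENNReal.ofReal_mul (gaussianPDFReal_nonneg 0 1 _)]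

lemma slice {V : Set ℝ} {z δ t : ℝ} (hV : ∀ x ∈ V, ∀ y, x ≤ y → y ∈ V) (hz : ∀ x ∈ V, z < x)
    (hδ : 0 ≤ δ) (hδ1 : δ ≤ 1) (ht : 0 ≤ t) (hzt : z ≤ t) :
    gaussianReal 0 1 (V ∩ Set.Iic (z + δ)) ≤
      ENNReal.ofReal (δ * (t + 1)) * gaussianReal 0 1 V := by
  rcases V.eq_empty_or_nonempty with rfl | hne
  · simp
  have hbd : BddBelow V := ⟨z, fun x hx => (hz x hx).le⟩
  set a := sInf V
  have haz : z ≤ a := le_csInf hne fun x hx => (hz x hx).le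
  have h1 : V ∩ Set.Iic (z + δ) ⊆ Set.Icc a (z + δ) := fun x hx => ⟨csInf_le hbd hx.1, hx.2⟩
  have h2 : Set.Ioi a ⊆ V := by
    intro x hx
    obtain ⟨w, hw, hwx⟩ := exists_lt_of_csInf_lt hne hx
    exact hV w hw x hwx.le
  have h3 : Set.Ioi (max a 0) ⊆ V := (Set.Ioi_subset_Ioi (le_max_left _ _)).trans h2
  refine (measure_mono h1).trans (gap.trans ?_)
  refine le_trans ?_ (mul_le_mul_right (measure_mono h3) _)
  rw [← ENNReal.ofReal_toReal (measure_ne_top (gaussianReal 0 1) (Set.Ioi (max a 0))),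
    ← ENNReal.ofReal_mul (by positivity)]
  apply ENNReal.ofReal_le_ofReal
  have hm := mills (le_max_right a 0)
  set p := (gaussianReal 0 1 (Set.Ioi (max a 0))).toReal
  have hp : 0 ≤ p := ENNReal.toReal_nonneg
  have hφ := gaussianPDFReal_nonneg 0 1 (max a 0)
  rcases le_total (z + δ - a) 0 with hs | hs
  · refine (mul_nonpos_of_nonpos_of_nonneg hs hφ).trans (by positivity)
  calc _ ≤ (z + δ - a) * ((max a 0 + 1) * p) := by gcongr
    _ = ((z + δ - a) * (max a 0 + 1)) * p := by ring
    _ ≤ _ := by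
      refine mul_le_mul_of_nonneg_right ?_ hp
      rcases le_total a 0 with h | h
      · rw [max_eq_right h]; nlinarith
      · rw [max_eq_left h]
        nlinarith [mul_nonneg (sub_nonneg.2 haz) hs, mul_nonneg (sub_nonneg.2 haz) (sub_nonneg.2 hδ1), mul_nonneg (sub_nonneg.2 haz) h, mul_nonneg hδ (sub_nonneg.2 hzt), mul_nonneg hs (sub_nonneg.2 hzt)]

lemma far {z δ : ℝ} {m : ℕ} (hm : 1 ≤ m) (hδ : 0 ≤ δ) (hz : Real.sqrt (2 * Real.log m) ≤ z) :
    gaussianReal 0 1 (Set.Icc z (z + δ)) ≤ ENNReal.ofReal (δ / m) := by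
  refine gap.trans (ENNReal.ofReal_le_ofReal ?_)
  have hz0 : 0 ≤ z := (Real.sqrt_nonneg _).trans hz
  have hm0 : (0:ℝ) < m := by exact_mod_cast hm
  rw [max_eq_left hz0, add_sub_cancel_left, div_eq_mul_inv]
  gcongr
  refine (phi_le_exp z).trans ?_
  rw [← Real.exp_log (inv_pos.2 hm0), Real.log_inv]
  apply Real.exp_le_exp.2
  have := (Real.sqrt_le_iff.1 hz).2
  linarith

lemma fubini {Ω E : Type*} [MeasurableSpace Ω] [MeasurableSpace E] {P : Measure Ω}
    [IsProbabilityMeasure P] {X : Ω → ℝ} {R : Ω → E} (hX : Measurable X) (hR : Measurable R)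
    (hind : IndepFun X R P) (hlaw : P.map X = gaussianReal 0 1)
    {U : Set (ℝ × E)} (hU : MeasurableSet U) {z δ t : ℝ}
    (hup : ∀ r x y, (x, r) ∈ U → x ≤ y → (y, r) ∈ U) (hz : ∀ r x, (x, r) ∈ U → z < x)
    (hδ : 0 ≤ δ) (hδ1 : δ ≤ 1) (ht : 0 ≤ t) (hzt : z ≤ t) :
    P {ω | (X ω, R ω) ∈ U ∧ X ω ≤ z + δ} ≤
      ENNReal.ofReal (δ * (t + 1)) * P {ω | (X ω, R ω) ∈ U} := by
  have hprod := (indepFun_iff_map_prod_eq_prod_map_map hX.aemeasurable hR.aemeasurable).1 hind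
  rw [hlaw] at hprod
  have : IsProbabilityMeasure (P.map R) := Measure.isProbabilityMeasure_map hR.aemeasurable
  have hXR : Measurable (fun ω => (X ω, R ω)) := hX.prodMk hR
  have hU' : MeasurableSet (U ∩ Prod.fst ⁻¹' Set.Iic (z + δ)) :=
    hU.inter (measurable_fst measurableSet_Iic)
  have e1 : P {ω | (X ω, R ω) ∈ U} = P.map (fun ω => (X ω, R ω)) U := by
    rw [Measure.map_apply hXR hU]; rfl
  have e2 : P {ω | (X ω, R ω) ∈ U ∧ X ω ≤ z + δ} =
      P.map (fun ω => (X ω, R ω)) (U ∩ Prod.fst ⁻¹' Set.Iic (z + δ)) := by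
    rw [Measure.map_apply hXR hU']; rfl
  rw [e1, e2, hprod, Measure.prod_apply_symm hU, Measure.prod_apply_symm hU',
    ← lintegral_const_mul _ (measurable_measure_prodMk_right hU)]
  refine lintegral_mono fun r => ?_
  exact slice (V := (fun x => (x, r)) ⁻¹' U) (fun x hx y hxy => hup r x y hx hxy)
    (fun x hx => hz r x hx) hδ hδ1 ht hzt

/-- `j` is the first maximizer of `W - z`. -/
def FM {m : ℕ} (z W : Fin m → ℝ) (j : Fin m) : Prop :=
  ∀ k, W k - z k ≤ W j - z j ∧ (k < j → W k - z k < W j - z j)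

lemma FM_exists {m : ℕ} (hm : 1 ≤ m) (z W : Fin m → ℝ) : ∃ j, FM z W j := by
  have : Nonempty (Fin m) := ⟨⟨0, hm⟩⟩
  classical
  have hne : (Finset.univ.filter fun j : Fin m => ∀ k, W k - z k ≤ W j - z j).Nonempty := by
    obtain ⟨j, hj⟩ := Finite.exists_max (fun j => W j - z j)
    exact ⟨j, by simpa using hj⟩
  refine ⟨_, fun k => ⟨(Finset.mem_filter.1 (Finset.min'_mem _ hne)).2 k, fun hk => ?_⟩⟩
  have h := (Finset.mem_filter.1 (Finset.min'_mem _ hne)).2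
  by_contra! hc
  have : k ∈ (Finset.univ.filter fun j : Fin m => ∀ k, W k - z k ≤ W j - z j) := by
    simp only [Finset.mem_filter, Finset.mem_univ, true_and]
    exact fun l => (h l).trans hc
  exact absurd (Finset.min'_le _ _ this) (not_le.2 hk)

lemma FM_unique {m : ℕ} {z W : Fin m → ℝ} {i j : Fin m} (hi : FM z W i) (hj : FM z W j) :
    i = j := by
  rcases lt_trichotomy i j with h | h | h
  · exact absurd ((hj i).2 h) (not_lt.2 (hi j).1)
  · exact h
  · exact absurd ((hi j).2 h) (not_lt.2 (hj i).1)

lemma FM_meas {m : ℕ} (z : Fin m → ℝ) (j : Fin m) : MeasurableSet {W : Fin m → ℝ | FM z W j} := by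
  unfold FM
  simp only [Set.ofPred_forall, Set.ofPred_and]
  refine MeasurableSet.iInter fun k => MeasurableSet.inter ?_ ?_
  · exact measurableSet_le (by fun_prop) (by fun_prop)
  · refine MeasurableSet.iInter fun _ => ?_
    exact measurableSet_lt (by fun_prop) (by fun_prop)

lemma near {Ω : Type*} [MeasurableSpace Ω] {P : Measure Ω} [IsProbabilityMeasure P] {m : ℕ}
    {W : Ω → Fin m → ℝ} (hW : Measurable W) (hG : HasGaussianLaw W P)
    (h0 : ∀ j, P[fun ω => W ω j] = 0) (h1 : ∀ j, Var[fun ω => W ω j; P] = 1)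
    (z : Fin m → ℝ) (j : Fin m) {δ t : ℝ}
    (hδ : 0 ≤ δ) (hδ1 : δ ≤ 1) (ht : 0 ≤ t) (hzt : z j ≤ t) :
    P {ω | (FM z (W ω) j ∧ z j < W ω j) ∧ W ω j ≤ z j + δ} ≤
      ENNReal.ofReal (δ * (t + 1)) * P {ω | FM z (W ω) j ∧ z j < W ω j} := by
  have hL2 : ∀ k, MemLp (fun ω => W ω k) 2 P := fun k => (hG.eval k).memLp_two
  set ρ : Fin m → ℝ := fun k => cov[fun ω => W ω k, fun ω => W ω j; P] with hρ
  have hρj : ρ j = 1 := by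
    simp only [hρ]; rw [covariance_self (by fun_prop)]; exact h1 j
  have hρ1 : ∀ k, ρ k ≤ 1 := by
    intro k
    have h := variance_nonneg (fun ω => W ω k - W ω j) P
    rw [variance_fun_sub (hL2 k) (hL2 j), h1, h1] at h
    simp only [hρ]; linarith
  let R : Ω → Fin m → ℝ := fun ω k => W ω k - ρ k * W ω j
  have hR : Measurable R := by fun_prop
  have hpair : HasGaussianLaw (fun ω => ((fun _ : Unit => W ω j), R ω)) P := by
    let L : (Fin m → ℝ) →L[ℝ] (Unit → ℝ) × (Fin m → ℝ) :=
      (ContinuousLinearMap.pi fun _ => ContinuousLinearMap.proj j).prod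
        (ContinuousLinearMap.pi fun k => ContinuousLinearMap.proj k - ρ k • ContinuousLinearMap.proj j)
    exact hG.map_fun L
  have hind' := HasGaussianLaw.indepFun_of_covariance_eval
    (X := fun (_ : Unit) ω => W ω j) (Y := fun k ω => R ω k) hpair (by
      intro _ k
      simp only [R]
      rw [covariance_fun_sub_right (hL2 j) (hL2 k) ((hL2 j).const_mul _),
        covariance_const_mul_right, covariance_self (by fun_prop), h1, covariance_comm]
      simp [hρ])
  have hind : IndepFun (fun ω => W ω j) R P :=
    hind'.comp (φ := fun f : Unit → ℝ => f ()) (ψ := id) (by fun_prop) measurable_id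
  have hlaw : P.map (fun ω => W ω j) = gaussianReal 0 1 := by
    rw [(hG.eval j).map_eq_gaussianReal, h0, h1]; simp
  let Q : ℝ × (Fin m → ℝ) → Fin m → ℝ := fun p k => ρ k * p.1 + p.2 k
  have hQ : Measurable Q := by fun_prop
  let U : Set (ℝ × (Fin m → ℝ)) := {p | (∀ k, ρ k * p.1 + p.2 k - z k ≤ p.1 - z j ∧
    (k < j → ρ k * p.1 + p.2 k - z k < p.1 - z j)) ∧ z j < p.1}
  have hU : MeasurableSet U := by
    simp only [U, Set.ofPred_forall, Set.ofPred_and]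
    refine MeasurableSet.inter (MeasurableSet.iInter fun k => MeasurableSet.inter ?_ ?_) ?_
    · exact measurableSet_le (by fun_prop) (by fun_prop)
    · refine MeasurableSet.iInter fun _ => ?_
      exact measurableSet_lt (by fun_prop) (by fun_prop)
    · exact measurableSet_lt (by fun_prop) (by fun_prop)
  have key := fubini (U := U) (z := z j) (by fun_prop) hR hind hlaw hU (by
      rintro r x y ⟨hx, hzx⟩ hxy
      have hmul : ∀ k, 0 ≤ (1 - ρ k) * (y - x) := fun k =>
        mul_nonneg (sub_nonneg.2 (hρ1 k)) (sub_nonneg.2 hxy)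
      refine ⟨fun k => ⟨?_, fun hk => ?_⟩, lt_of_lt_of_le hzx hxy⟩
      · have := (hx k).1; have := hmul k; simp only at *; nlinarith
      · have := (hx k).2 hk; have := hmul k; simp only at *; nlinarith)
    (fun r x hx => hx.2) hδ hδ1 ht hzt
  have e : ∀ ω, (W ω j, R ω) ∈ U ↔ (FM z (W ω) j ∧ z j < W ω j) := by
    intro ω
    simp [U, R, FM]
  simpa only [e] using key

lemma core {Ω : Type*} [MeasurableSpace Ω] {P : Measure Ω} [IsProbabilityMeasure P] {m : ℕ}
    (hm : 1 ≤ m)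
    {W : Ω → Fin m → ℝ} (hW : Measurable W) (hG : HasGaussianLaw W P)
    (h0 : ∀ j, P[fun ω => W ω j] = 0) (h1 : ∀ j, Var[fun ω => W ω j; P] = 1)
    (z : Fin m → ℝ) {δ : ℝ} (hδ : 0 ≤ δ) :
    P.real {ω | ∀ j, W ω j ≤ z j + δ} ≤ P.real {ω | ∀ j, W ω j ≤ z j} +
      δ * (Real.sqrt (2 * Real.log m) + 2) := by
  set t := Real.sqrt (2 * Real.log m)
  have ht : 0 ≤ t := Real.sqrt_nonneg _
  have hm0 : (0:ℝ) < m := by exact_mod_cast hm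
  rcases lt_or_ge 1 δ with hδ1 | hδ1
  · have a1 : P.real {ω | ∀ j, W ω j ≤ z j + δ} ≤ 1 := measureReal_le_one
    have a2 : 0 ≤ P.real {ω | ∀ j, W ω j ≤ z j} := measureReal_nonneg
    nlinarith
  let T : Fin m → Set Ω := fun j => {ω | FM z (W ω) j ∧ z j < W ω j}
  let S : Fin m → Set Ω := fun j => {ω | (FM z (W ω) j ∧ z j < W ω j) ∧ W ω j ≤ z j + δ}
  have hT : ∀ j, MeasurableSet (T j) := fun j =>
    (hW (FM_meas z j)).inter (measurableSet_lt measurable_const ((measurable_pi_apply j).comp hW))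
  have hdisj : Pairwise (Function.onFun Disjoint T) := by
    intro i j hij
    refine Set.disjoint_left.2 fun ω hi hj => hij (FM_unique hi.1 hj.1)
  have hsum : ∑ j, P.real (T j) ≤ 1 := by
    rw [← measureReal_iUnion_fintype hdisj hT]
    exact measureReal_le_one
  have hS : ∀ j, P.real (S j) ≤ δ * (t + 1) * P.real (T j) + δ / m := by
    intro j
    rcases le_total (z j) t with h | h
    · have := near hW hG h0 h1 z j hδ hδ1 ht h
      have := ENNReal.toReal_mono (by finiteness) this
      rw [ENNReal.toReal_mul, ENNReal.toReal_ofReal (by positivity)] at this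
      have h' : 0 ≤ δ / m := by positivity
      exact this.trans (le_add_of_nonneg_right h')
    · have hlaw : P.map (fun ω => W ω j) = gaussianReal 0 1 := by
        rw [(hG.eval j).map_eq_gaussianReal, h0, h1]; simp
      have hf := far hm hδ h
      rw [← hlaw, Measure.map_apply (by fun_prop) measurableSet_Icc] at hf
      have hle : P (S j) ≤ ENNReal.ofReal (δ / m) :=
        by
        refine le_trans (measure_mono ?_) hf
        intro ω hω
        exact ⟨hω.1.2.le, hω.2⟩
      have := ENNReal.toReal_mono (by finiteness) hle
      rw [ENNReal.toReal_ofReal (by positivity)] at this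
      have h' : 0 ≤ δ * (t + 1) * P.real (T j) := by positivity
      exact this.trans (le_add_of_nonneg_left h')
  have hsub : {ω | ∀ j, W ω j ≤ z j + δ} ⊆ {ω | ∀ j, W ω j ≤ z j} ∪ ⋃ j, S j := by
    intro ω hω
    by_cases h : ∀ j, W ω j ≤ z j
    · exact Or.inl h
    · right
      push Not at h
      obtain ⟨k, hk⟩ := h
      obtain ⟨j, hj⟩ := FM_exists hm z (W ω)
      refine Set.mem_iUnion.2 ⟨j, ⟨hj, ?_⟩, hω j⟩
      have := (hj k).1
      linarith
  calc P.real {ω | ∀ j, W ω j ≤ z j + δ}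
      ≤ P.real ({ω | ∀ j, W ω j ≤ z j} ∪ ⋃ j, S j) := measureReal_mono hsub
    _ ≤ P.real {ω | ∀ j, W ω j ≤ z j} + P.real (⋃ j, S j) := measureReal_union_le _ _
    _ ≤ P.real {ω | ∀ j, W ω j ≤ z j} + ∑ j, P.real (S j) := by
        gcongr; exact measureReal_iUnion_fintype_le _
    _ ≤ P.real {ω | ∀ j, W ω j ≤ z j} + ∑ j, (δ * (t + 1) * P.real (T j) + δ / m) := by
        gcongr with j; exact hS j
    _ ≤ _ := by
        rw [Finset.sum_add_distrib, ← Finset.mul_sum]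
        simp only [Finset.sum_const, Finset.card_univ, Fintype.card_fin, nsmul_eq_mul]
        rw [mul_div_cancel₀ _ hm0.ne']
        have : δ * (t + 1) * ∑ j, P.real (T j) ≤ δ * (t + 1) * 1 := by gcongr
        linarith

lemma onesided {Ω : Type*} [MeasurableSpace Ω] {P : Measure Ω} [IsProbabilityMeasure P] {m : ℕ}
    (hm : 1 ≤ m)
    {ξ : Ω → Fin m → ℝ} (hW : Measurable ξ) (hG : HasGaussianLaw ξ P)
    (h0 : ∀ j, P[fun ω => ξ ω j] = 0) {b : ℝ} (hb : 0 < b)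
    (h1 : ∀ j, b ≤ Var[fun ω => ξ ω j; P])
    (u v y : Fin m → ℝ) :
    P.real {ω | ∀ j, ξ ω j + u j ≤ y j} ≤ P.real {ω | ∀ j, ξ ω j + v j ≤ y j} +
      (‖u - v‖ / Real.sqrt b) * (Real.sqrt (2 * Real.log m) + 2) := by
  let σ : Fin m → ℝ := fun j => Real.sqrt (Var[fun ω => ξ ω j; P])
  have hσb : ∀ j, Real.sqrt b ≤ σ j := fun j => Real.sqrt_le_sqrt (h1 j)
  have hsb : 0 < Real.sqrt b := Real.sqrt_pos.2 hb
  have hσ : ∀ j, 0 < σ j := fun j => hsb.trans_le (hσb j)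
  have hσ2 : ∀ j, σ j ^ 2 = Var[fun ω => ξ ω j; P] := fun j => Real.sq_sqrt (variance_nonneg _ _)
  let W : Ω → Fin m → ℝ := fun ω j => (σ j)⁻¹ * ξ ω j
  have hWG : HasGaussianLaw W P := by
    let L : (Fin m → ℝ) →L[ℝ] (Fin m → ℝ) :=
      ContinuousLinearMap.pi fun k => (σ k)⁻¹ • ContinuousLinearMap.proj k
    exact hG.map_fun L
  have hc := core (W := W) (P := P) hm (by fun_prop) hWG
    (by intro j; simp only [W]; rw [integral_const_mul, h0, mul_zero])
    (by
      intro j; simp only [W]; rw [variance_const_mul, ← hσ2]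
      have := (hσ j).ne'
      field_simp)
    (fun j => (σ j)⁻¹ * (y j - v j)) (δ := ‖u - v‖ / Real.sqrt b) (by positivity)
  have e2 : {ω | ∀ j, W ω j ≤ (σ j)⁻¹ * (y j - v j)} = {ω | ∀ j, ξ ω j + v j ≤ y j} := by
    ext ω
    refine forall_congr' fun j => ?_
    simp only [W]
    rw [mul_le_mul_iff_right₀ (inv_pos.2 (hσ j)), le_sub_iff_add_le]
  rw [e2] at hc
  refine le_trans (measureReal_mono ?_) hc
  intro ω hω j
  have h := hω j
  have hn : |u j - v j| ≤ ‖u - v‖ := norm_le_pi_norm (u - v) j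
  have hn' := neg_le_abs (u j - v j)
  have h3 : (σ j)⁻¹ * ‖u - v‖ ≤ ‖u - v‖ / Real.sqrt b := by
    rw [div_eq_inv_mul]
    gcongr
    exact hσb j
  have h4 : (σ j)⁻¹ * ξ ω j ≤ (σ j)⁻¹ * (y j - v j + ‖u - v‖) := by
    apply mul_le_mul_of_nonneg_left _ (inv_pos.2 (hσ j)).le
    linarith
  rw [mul_add] at h4
  simp only [W]
  linarith

theorem stmt12
    {Ω : Type*} [MeasureSpace Ω] [IsProbabilityMeasure (ℙ : Measure Ω)]
    (m : ℕ) (hm : 1 ≤ m)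
    (ξ : Ω → Fin m → ℝ) (hmeas : Measurable ξ)
    (hgauss : ∀ t : Fin m → ℝ, ∃ v : ℝ≥0,
      Measure.map (fun ω => ∑ j, t j * ξ ω j) ℙ = gaussianReal 0 v)
    (b : ℝ) (hb : 0 < b)
    (hvar : ∀ j, b ≤ ∫ ω, (ξ ω j) ^ 2 ∂ℙ)
    (u v : Fin m → ℝ) :
    ∀ y : Fin m → ℝ,
      |(ℙ {ω | ∀ j, ξ ω j + u j ≤ y j}).toReal -
          (ℙ {ω | ∀ j, ξ ω j + v j ≤ y j}).toReal| ≤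
        (‖u - v‖ / Real.sqrt b) * (Real.sqrt (2 * Real.log m) + 2) := by
  intro y
  have hG : HasGaussianLaw ξ (ℙ : Measure Ω) := by
    constructor
    apply isGaussian_of_map_eq_gaussianReal
    intro L
    obtain ⟨w, hw⟩ := hgauss (fun j => L (Pi.single j 1))
    refine ⟨0, w, ?_⟩
    rw [Measure.map_map (by fun_prop) hmeas, ← hw]
    congr 1
    ext ω
    simp only [Function.comp]
    conv_lhs => rw [pi_eq_sum_univ' (ξ ω), map_sum]
    refine Finset.sum_congr rfl fun j _ => ?_
    rw [map_smul, smul_eq_mul, mul_comm]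
  have h0 : ∀ j, ∫ ω, ξ ω j ∂(ℙ : Measure Ω) = 0 := by
    intro j
    obtain ⟨w, hw⟩ := hgauss (Pi.single j 1)
    have e : (fun ω => ∑ i, (Pi.single j 1 : Fin m → ℝ) i * ξ ω i) = fun ω => ξ ω j := by
      ext ω
      simp [Pi.single_apply]
    rw [e] at hw
    have : ∫ ω, ξ ω j ∂(ℙ : Measure Ω) = ∫ x, x ∂(Measure.map (fun ω => ξ ω j) ℙ) := by
      rw [integral_map (by fun_prop) (by fun_prop)]
    rw [this, hw, integral_id_gaussianReal]
  have h1 : ∀ j, b ≤ Var[fun ω => ξ ω j; (ℙ : Measure Ω)] := by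
    intro j
    rw [variance_of_integral_eq_zero (by fun_prop) (h0 j)]
    exact hvar j
  have a1 := onesided hm hmeas hG h0 hb h1 u v y
  have a2 := onesided hm hmeas hG h0 hb h1 v u y
  rw [norm_sub_rev] at a2
  simp only [Measure.real] at a1 a2
  rw [abs_le]
  constructor <;> linarith
end
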